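/- arXiv:2411.04238 — 2 statements merged into one kernel-verified Lean document; each statement's English description precedes it below -/
import Mathlib

section
/- Fix λ₁₂, λ₂₁ > 0, set λ := λ₁₂ + λ₂₁, and fix u₁, u₂ ∈ ℝ. Define for t ≥ 0: ψ₁(t) := log( (λ₁₂(e^{u₁} − e^{u₂})e^{−λt} + λ₂₁e^{u₁} + λ₁₂e^{u₂}) / λ ) and ψ₂(t) := log( (−λ₂₁(e^{u₁} − e^{u₂})e^{−λt} + λ₂₁e^{u₁} + λ₁₂e^{u₂}) / λ ). Then the arguments of both logarithms are strictly positive for all t ≥ 0, ψ₁(0) = u₁ and ψ₂(0) = u₂, and ψ₁, ψ₂ are differentiable with ψ₁'(t) = λ₁₂·(exp(ψ₂(t) − ψ₁(t)) − 1) and ψ₂'(t) = λ₂₁·(exp(ψ₁(t) − ψ₂(t)) − 1) for all t ≥ 0. -/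
namespace Paper

/-- `ψ₁` for the two-state Riccati system. -/
noncomputable def psi1 (l12 l21 u1 u2 t : ℝ) : ℝ :=
  Real.log ((l12 * (Real.exp u1 - Real.exp u2) * Real.exp (-(l12 + l21) * t)
    + l21 * Real.exp u1 + l12 * Real.exp u2) / (l12 + l21))

/-- `ψ₂` for the two-state Riccati system. -/
noncomputable def psi2 (l12 l21 u1 u2 t : ℝ) : ℝ :=
  Real.log ((-l21 * (Real.exp u1 - Real.exp u2) * Real.exp (-(l12 + l21) * t)
    + l21 * Real.exp u1 + l12 * Real.exp u2) / (l12 + l21))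

/-- A positive combination of `a` and `b` stays positive after adding `l12 * (a - b) * s`,
`0 < s ≤ 1`. -/
theorem interpolation_pos {l12 l21 a b s : ℝ} (h12 : 0 < l12) (h21 : 0 < l21)
    (ha : 0 < a) (hb : 0 < b) (hs : 0 < s) (hs1 : s ≤ 1) :
    0 < l12 * (a - b) * s + l21 * a + l12 * b := by
  have h1 : 0 ≤ l12 * b * (1 - s) := mul_nonneg (by positivity) (by linarith)
  have h2 : 0 < l12 * a * s := by positivity
  have h3 : 0 < l21 * a := by positivity
  linarith

theorem hasDerivAt_log_exp_add_div {c k p q t : ℝ} (hk : k ≠ 0)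
    (h : c * Real.exp (-k * t) + p + q ≠ 0) :
    HasDerivAt (fun t => Real.log ((c * Real.exp (-k * t) + p + q) / k))
      (-k * c * Real.exp (-k * t) / (c * Real.exp (-k * t) + p + q)) t := by
  have hexp : HasDerivAt (fun t => Real.exp (-k * t)) (Real.exp (-k * t) * -k) t := by
    simpa using ((hasDerivAt_id t).const_mul (-k)).exp
  convert ((((hexp.const_mul c).add_const p).add_const q).div_const k).log
    (div_ne_zero h hk) using 1
  field_simp

/-- Explicit solution of the two-dimensional Riccati ODE system for a two-state
continuous-time Markov chain: positivity of the arguments of the logarithms, the initial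
conditions, and the Riccati differential equations. -/
theorem statement18 (l12 l21 : ℝ) (h12 : 0 < l12) (h21 : 0 < l21) (u1 u2 : ℝ) :
    (∀ t : ℝ, 0 ≤ t →
      0 < (l12 * (Real.exp u1 - Real.exp u2) * Real.exp (-(l12 + l21) * t)
            + l21 * Real.exp u1 + l12 * Real.exp u2) / (l12 + l21) ∧
      0 < (-l21 * (Real.exp u1 - Real.exp u2) * Real.exp (-(l12 + l21) * t)
            + l21 * Real.exp u1 + l12 * Real.exp u2) / (l12 + l21)) ∧
    psi1 l12 l21 u1 u2 0 = u1 ∧ psi2 l12 l21 u1 u2 0 = u2 ∧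
    (∀ t : ℝ, 0 ≤ t →
      HasDerivAt (psi1 l12 l21 u1 u2)
        (l12 * (Real.exp (psi2 l12 l21 u1 u2 t - psi1 l12 l21 u1 u2 t) - 1)) t ∧
      HasDerivAt (psi2 l12 l21 u1 u2)
        (l21 * (Real.exp (psi1 l12 l21 u1 u2 t - psi2 l12 l21 u1 u2 t) - 1)) t) := by
  have hl : 0 < l12 + l21 := add_pos h12 h21
  have hle : ∀ t : ℝ, 0 ≤ t → Real.exp (-(l12 + l21) * t) ≤ 1 := fun t ht =>
    Real.exp_le_one_iff.2 (by nlinarith)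
  have pos1 : ∀ t : ℝ, 0 ≤ t → 0 < l12 * (Real.exp u1 - Real.exp u2) *
      Real.exp (-(l12 + l21) * t) + l21 * Real.exp u1 + l12 * Real.exp u2 := fun t ht =>
    interpolation_pos h12 h21 (Real.exp_pos _) (Real.exp_pos _) (Real.exp_pos _) (hle t ht)
  have pos2 : ∀ t : ℝ, 0 ≤ t → 0 < -l21 * (Real.exp u1 - Real.exp u2) *
      Real.exp (-(l12 + l21) * t) + l21 * Real.exp u1 + l12 * Real.exp u2 := fun t ht => by
    have := interpolation_pos h21 h12 (Real.exp_pos u2) (Real.exp_pos u1)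
      (Real.exp_pos _) (hle t ht)
    linarith
  refine ⟨fun t ht => ⟨div_pos (pos1 t ht) hl, div_pos (pos2 t ht) hl⟩, ?_, ?_,
    fun t ht => ?_⟩
  · refine Eq.trans (congrArg Real.log ?_) (Real.log_exp u1)
    rw [mul_zero, Real.exp_zero, div_eq_iff hl.ne']
    ring
  · refine Eq.trans (congrArg Real.log ?_) (Real.log_exp u2)
    rw [mul_zero, Real.exp_zero, div_eq_iff hl.ne']
    ring
  · have h1 := pos1 t ht
    have h2 := pos2 t ht
    have e1 := Real.exp_log (div_pos h1 hl)
    have e2 := Real.exp_log (div_pos h2 hl)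
    rw [← psi1] at e1
    rw [← psi2] at e2
    rw [Real.exp_sub, Real.exp_sub, e1, e2, div_div_div_cancel_right₀ hl.ne',
      div_div_div_cancel_right₀ hl.ne', div_sub_one h1.ne', div_sub_one h2.ne',
      ← mul_div_assoc, ← mul_div_assoc]
    constructor
    · refine (hasDerivAt_log_exp_add_div hl.ne' h1.ne').congr_deriv ?_
      congr 1
      ring
    · refine (hasDerivAt_log_exp_add_div hl.ne' h2.ne').congr_deriv ?_
      congr 1
      ring

end Paper
end

section
/- Let k ≥ 2 be an integer and define f_j : ℝ → ℝ by f_j(x) := (x/2)^j for j ∈ ℕ₀. Then for every real x ≠ 0: (1/2)·x(1−x)(1−x/2)·f_k''(x) + ((1−x)(1−x/2)/x)·( f_k(0) − f_k(x) + x·f_k'(x) ) = ((k+2)(k−1)/4)·( f_{k−1}(x) + 2·f_{k+1}(x) − 3·f_k(x) ). -/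
theorem deriv_div_const_pow (c : ℝ) (n : ℕ) :
    deriv (fun y : ℝ => (y / c) ^ n) = fun y => n * (y / c) ^ (n - 1) / c := by
  funext y
  simp [div_eq_mul_inv]

/-- The action of the generator `𝒜f(x) = ½·x(1−x)(1−x/2)·f''(x)
+ ((1−x)(1−x/2)/x)·(f(0) − f(x) + x·f'(x))` on the monomials `f_k(x) = (x/2)^k`:
for `k ≥ 2` and `x ≠ 0`,
`𝒜f_k(x) = ((k+2)(k−1)/4)·(f_{k−1}(x) + 2f_{k+1}(x) − 3f_k(x))`. -/
theorem statement19 (k : ℕ) (hk : 2 ≤ k) (x : ℝ) (hx : x ≠ 0) :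
    (1 / 2) * (x * (1 - x) * (1 - x / 2)) * deriv (deriv (fun y : ℝ => (y / 2) ^ k)) x
      + ((1 - x) * (1 - x / 2) / x) *
          (((0 : ℝ) / 2) ^ k - (x / 2) ^ k + x * deriv (fun y : ℝ => (y / 2) ^ k) x)
    = (((k : ℝ) + 2) * ((k : ℝ) - 1) / 4) *
        ((x / 2) ^ (k - 1) + 2 * (x / 2) ^ (k + 1) - 3 * (x / 2) ^ k) := by
  obtain ⟨m, rfl⟩ := Nat.exists_eq_add_of_le' hk
  have h2 : deriv (fun y : ℝ => ((m + 2 : ℕ) : ℝ) * (y / 2) ^ (m + 2 - 1) / 2) x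
      = ((m + 2 : ℕ) : ℝ) * (((m + 1 : ℕ) : ℝ) * (x / 2) ^ m / 2) / 2 := by
    rw [deriv_div_const, deriv_const_mul_field, deriv_div_const_pow]
    rfl
  rw [deriv_div_const_pow, h2]
  simp only [zero_div, zero_pow (Nat.succ_ne_zero (m + 1)), Nat.add_succ_sub_one]
  push_cast
  field_simp
  ring
end
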